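/- arXiv:2404.15841 — 7 statements merged into one kernel-verified Lean document; each statement's English description precedes it below -/
import Mathlib

section
/- Let p > 2 be real, λ ∈ ℝ, a > 0, and M > 0 with M^(p−2) > (p/2)·λ. Suppose u : ℝ → ℝ is twice continuously differentiable on [0,a], satisfies u''(x) + u(x)^(p−1) = λ·u(x) and u(x) > 0 for every x ∈ [0,a], u is nonincreasing on [0,a], u(0) = M, and u'(0) = 0. Then M^(p−2) ≤ (p/2)·λ + p·π²/(8·a²). -/
open Real Set MeasureTheory Filter

/-- Conservation of energy for `u'' + u^(p-1) = λ u` along a positive solution. -/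
lemma nls_energy_conservation {p lam a : ℝ} (hp : 2 < p) {u u' u'' : ℝ → ℝ}
    (hd1 : ∀ x ∈ Icc 0 a, HasDerivAt u (u' x) x)
    (hd2 : ∀ x ∈ Icc 0 a, HasDerivAt u' (u'' x) x)
    (heq : ∀ x ∈ Icc 0 a, u'' x + u x ^ (p - 1) = lam * u x)
    (hpos : ∀ x ∈ Icc 0 a, 0 < u x) {x : ℝ} (hx : x ∈ Icc 0 a) :
    u' x ^ 2 + 2 / p * u x ^ p - lam * u x ^ 2 =
      u' 0 ^ 2 + 2 / p * u 0 ^ p - lam * u 0 ^ 2 := by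
  have hder : ∀ y ∈ Icc 0 a,
      HasDerivAt (fun z => u' z ^ 2 + 2 / p * u z ^ p - lam * u z ^ 2) 0 y := by
    intro y hy
    have h := (((hd2 y hy).pow 2).add
      (((hd1 y hy).rpow_const (p := p) (Or.inl (hpos y hy).ne')).const_mul (2 / p))).sub
      (((hd1 y hy).pow 2).const_mul lam)
    refine h.congr_deriv ?_
    have h2 : u'' y = lam * u y - u y ^ (p - 1) := by linarith [heq y hy]
    rw [h2]
    field_simp
    ring
  exact constant_of_has_deriv_right_zero
    (fun y hy => (hder y hy).continuousAt.continuousWithinAt)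
    (fun y hy => (hder y (Ico_subset_Icc_self hy)).hasDerivWithinAt) x hx

/-- If `u` satisfies the phase-plane inequality `k √(M² - u²) ≤ -u'` on `(0,a)` and stays in
`(0,M)` there, then the length of the interval is at most a quarter period `π / (2k)`. -/
lemma mul_length_le_pi_div_two {a M k : ℝ} (ha : 0 < a) (hM : 0 < M) {u u' : ℝ → ℝ}
    (hcont : ContinuousOn u (Icc 0 a))
    (hd : ∀ x ∈ Ioo 0 a, HasDerivAt u (u' x) x)
    (hpos : ∀ x ∈ Icc 0 a, 0 < u x) (hlt : ∀ x ∈ Ioo 0 a, u x < M) (hu0 : u 0 = M)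
    (hineq : ∀ x ∈ Ioo 0 a, k * √(M ^ 2 - u x ^ 2) ≤ -u' x) :
    k * a ≤ π / 2 := by
  have hmono : MonotoneOn (fun x => arccos (u x / M) - k * x) (Icc 0 a) := by
    refine monotoneOn_of_hasDerivWithinAt_nonneg (convex_Icc 0 a)
      ((continuous_arccos.comp_continuousOn (hcont.div_const M)).sub (by fun_prop))
      (f' := fun x => -(1 / √(1 - (u x / M) ^ 2)) * (u' x / M) - k * 1) ?_ ?_
    · intro x hx
      rw [interior_Icc] at hx
      have h0 := hpos x (Ioo_subset_Icc_self hx)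
      have h1 : u x / M < 1 := (div_lt_one hM).2 (hlt x hx)
      have h2 : 0 < u x / M := div_pos h0 hM
      exact (((hasDerivAt_arccos (by linarith) h1.ne).comp x ((hd x hx).div_const M)).sub
        ((hasDerivAt_id x).const_mul k)).hasDerivWithinAt
    · intro x hx
      rw [interior_Icc] at hx
      have h0 := hpos x (Ioo_subset_Icc_self hx)
      have hs : √(1 - (u x / M) ^ 2) = √(M ^ 2 - u x ^ 2) / M := by
        rw [← sqrt_sq hM.le, ← sqrt_div' _ (sq_nonneg M), sqrt_sq hM.le]
        congr 1
        field_simp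
      have hs0 : 0 < √(M ^ 2 - u x ^ 2) := sqrt_pos.2 (by nlinarith [hlt x hx])
      have h : -(1 / (√(M ^ 2 - u x ^ 2) / M)) * (u' x / M) = -u' x / √(M ^ 2 - u x ^ 2) := by
        field_simp
      rw [hs, h, mul_one, sub_nonneg, le_div_iff₀ hs0]
      exact hineq x hx
  have h := hmono (left_mem_Icc.2 ha.le) (right_mem_Icc.2 ha.le) ha.le
  have h2 : arccos (u a / M) ≤ π / 2 :=
    arccos_le_pi_div_two.2 (div_pos (hpos a (right_mem_Icc.2 ha.le)) hM).le
  simp only [hu0, div_self hM.ne', arccos_one] at h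
  linarith

/-- Phase-plane interval estimate: if `u` is a positive, nonincreasing C² solution of
`u'' + u^(p-1) = λ u` on `[0,a]` starting at a local maximum of height `M` with
`M^(p-2) > (p/2)λ`, then `M^(p-2) ≤ (p/2)λ + pπ²/(8a²)`. -/
theorem stmt_0 (p lam a M : ℝ) (hp : 2 < p) (ha : 0 < a) (hM : 0 < M)
    (hMlam : M ^ (p - 2) > p / 2 * lam)
    (u u' u'' : ℝ → ℝ)
    (hd1 : ∀ x ∈ Icc 0 a, HasDerivAt u (u' x) x)
    (hd2 : ∀ x ∈ Icc 0 a, HasDerivAt u' (u'' x) x)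
    (hcont : ContinuousOn u'' (Icc 0 a))
    (heq : ∀ x ∈ Icc 0 a, u'' x + u x ^ (p - 1) = lam * u x)
    (hpos : ∀ x ∈ Icc 0 a, 0 < u x)
    (hmono : AntitoneOn u (Icc 0 a))
    (hu0 : u 0 = M) (hu'0 : u' 0 = 0) :
    M ^ (p - 2) ≤ p / 2 * lam + p * π ^ 2 / (8 * a ^ 2) := by
  have h0a : (0 : ℝ) ∈ Icc 0 a := left_mem_Icc.2 ha.le
  have hle : ∀ x ∈ Icc 0 a, u x ≤ M := fun x hx => hu0 ▸ hmono h0a hx hx.1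
  have hlt : ∀ x ∈ Ioo 0 a, u x < M := by
    intro x hx
    refine (hle x (Ioo_subset_Icc_self hx)).lt_of_ne fun hxM => ?_
    have hsub : ∀ y ∈ Ioo 0 x, y ∈ Icc 0 a := fun y hy => ⟨hy.1.le, (hy.2.trans hx.2).le⟩
    have hconst : ∀ y ∈ Ioo 0 x, u y = M := fun y hy =>
      (hle y (hsub y hy)).antisymm
        (hxM ▸ hmono (hsub y hy) (Ioo_subset_Icc_self hx) hy.2.le)
    have hu' : ∀ y ∈ Ioo 0 x, u' y = 0 := fun y hy =>
      (hd1 y (hsub y hy)).unique ((hasDerivAt_const y M).congr_of_eventuallyEq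
        (eventually_of_mem (isOpen_Ioo.mem_nhds hy) hconst))
    have hy : x / 2 ∈ Ioo 0 x := ⟨by linarith [hx.1], by linarith [hx.1]⟩
    have hu'' : u'' (x / 2) = 0 :=
      (hd2 _ (hsub _ hy)).unique ((hasDerivAt_const _ 0).congr_of_eventuallyEq
        (eventually_of_mem (isOpen_Ioo.mem_nhds hy) hu'))
    have h := heq _ (hsub _ hy)
    rw [hu'', hconst _ hy, show p - 1 = p - 2 + 1 by ring, rpow_add_one hM.ne', zero_add] at h
    have h1 : M ^ (p - 2) = lam := mul_right_cancel₀ hM.ne' h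
    have h2 : 0 < M ^ (p - 2) := rpow_pos_of_pos hM _
    nlinarith
  have hu'_nonpos : ∀ x ∈ Ioo 0 a, u' x ≤ 0 := by
    intro x hx
    have hx' := Ioo_subset_Icc_self hx
    rw [← (hd1 x hx').hasDerivWithinAt.derivWithin (uniqueDiffOn_Icc ha x hx')]
    exact hmono.derivWithin_nonpos
  set K := 2 / p * M ^ (p - 2) - lam with hK
  have hKpos : 0 < K := by
    have : K = 2 / p * (M ^ (p - 2) - p / 2 * lam) := by
      rw [hK]
      field_simp
    rw [this]
    exact mul_pos (by positivity) (by linarith)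
  have hineq : ∀ x ∈ Ioo 0 a, √K * √(M ^ 2 - u x ^ 2) ≤ -u' x := by
    intro x hx
    have hx' := Ioo_subset_Icc_self hx
    rw [← sqrt_mul hKpos.le]
    refine sqrt_le_iff.2 ⟨by linarith [hu'_nonpos x hx], ?_⟩
    have hE := nls_energy_conservation hp hd1 hd2 heq hpos hx'
    have hsplit : ∀ t : ℝ, 0 < t → t ^ p = t ^ (p - 2) * t ^ 2 := fun t ht => by
      rw [← rpow_natCast t 2, ← rpow_add ht]
      norm_num
    rw [hu'0, hu0, hsplit _ (hpos x hx'), hsplit M hM] at hE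
    have hpow : u x ^ (p - 2) ≤ M ^ (p - 2) :=
      rpow_le_rpow (hpos x hx').le (hle x hx') (by linarith)
    have h : 2 / p * (u x ^ (p - 2) * u x ^ 2) ≤ 2 / p * (M ^ (p - 2) * u x ^ 2) := by
      gcongr
    rw [hK]
    linarith
  have hka : √K * a ≤ π / 2 := mul_length_le_pi_div_two ha hM
    (fun x hx => (hd1 x hx).continuousAt.continuousWithinAt)
    (fun x hx => hd1 x (Ioo_subset_Icc_self hx)) hpos hlt hu0 hineq
  have hsq : K * a ^ 2 ≤ (π / 2) ^ 2 := by
    have h := pow_le_pow_left₀ (by positivity) hka 2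
    rwa [mul_pow, sq_sqrt hKpos.le] at h
  have hKle : K ≤ (π / 2) ^ 2 / a ^ 2 := (le_div_iff₀ (by positivity)).2 hsq
  have h1 : M ^ (p - 2) = p / 2 * lam + p / 2 * K := by
    rw [hK]
    field_simp
    ring
  have h2 : p * π ^ 2 / (8 * a ^ 2) = p / 2 * ((π / 2) ^ 2 / a ^ 2) := by
    field_simp
    ring
  rw [h1, h2]
  gcongr
end

section
/- Let p > 2 be real and λ > 0. Suppose u : ℝ → ℝ is twice continuously differentiable, u(x) > 0 for all x ∈ ℝ, u''(x) + u(x)^(p−1) = λ·u(x) for all x ∈ ℝ, and u(x) → 0 and u'(x) → 0 as x → ±∞. Then u attains its supremum at some point of ℝ and sup_{x ∈ ℝ} u(x) = (p·λ/2)^(1/(p−2)). -/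
open Real Set MeasureTheory Filter

/-- A function on `ℝ` with vanishing derivative equals its limit at `+∞` everywhere. -/
theorem eq_of_hasDerivAt_zero_of_tendsto_atTop {f : ℝ → ℝ} {a : ℝ}
    (hf : ∀ x, HasDerivAt f 0 x) (ha : Tendsto f atTop (nhds a)) (x : ℝ) : f x = a := by
  have hconst : f = fun _ => f x := funext fun y =>
    is_const_of_deriv_eq_zero (fun z => (hf z).differentiableAt) (fun z => (hf z).deriv) y x
  rw [hconst] at ha
  exact tendsto_nhds_unique tendsto_const_nhds ha

/-- A positive continuous function on `ℝ` vanishing at `±∞` attains its maximum. -/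
theorem exists_forall_le_of_pos_of_tendsto_zero {u : ℝ → ℝ} (hu : Continuous u)
    (hpos : ∀ x, 0 < u x) (htop : Tendsto u atTop (nhds 0)) (hbot : Tendsto u atBot (nhds 0)) :
    ∃ x₀, ∀ x, u x ≤ u x₀ := by
  refine hu.exists_forall_ge' 0 ?_
  rw [cocompact_eq_atBot_atTop, eventually_sup]
  exact ⟨hbot.eventually_le_const (hpos 0), htop.eventually_le_const (hpos 0)⟩

/-- The energy `u'² / 2 + u ^ p / p - λ u² / 2` of a decaying positive solution vanishes. -/
theorem energy_eq_zero {p lam : ℝ} (hp : 0 < p) {u : ℝ → ℝ} (hu : ContDiff ℝ 2 u)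
    (hpos : ∀ x, 0 < u x)
    (heq : ∀ x, deriv (deriv u) x + u x ^ (p - 1) = lam * u x)
    (htop : Tendsto u atTop (nhds 0)) (htop' : Tendsto (deriv u) atTop (nhds 0)) (x : ℝ) :
    deriv u x ^ 2 / 2 + u x ^ p / p - lam * u x ^ 2 / 2 = 0 := by
  have hu' : ContDiff ℝ 1 (deriv u) := ((contDiff_succ_iff_deriv (n := 1)).1 hu).2.2
  refine eq_of_hasDerivAt_zero_of_tendsto_atTop
    (f := fun x => deriv u x ^ 2 / 2 + u x ^ p / p - lam * u x ^ 2 / 2) (fun y => ?_) ?_ x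
  · have h1 : HasDerivAt u (deriv u y) y := (hu.differentiable (by norm_num) y).hasDerivAt
    have h2 : HasDerivAt (deriv u) (deriv (deriv u) y) y :=
      (hu'.differentiable (by norm_num) y).hasDerivAt
    have h3 := h1.rpow_const (p := p) (Or.inl (hpos y).ne')
    refine ((((h2.pow 2).div_const 2).add (h3.div_const p)).sub
      (((h1.pow 2).const_mul lam).div_const 2)).congr_deriv ?_
    have hp' : p ≠ 0 := hp.ne'
    field_simp
    linear_combination 2 * deriv u y * heq y
  · have h := (((htop'.pow 2).div_const 2).add
      ((htop.rpow_const (p := p) (Or.inr hp.le)).div_const p)).sub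
      (((htop.pow 2).const_mul lam).div_const 2)
    simpa [Real.zero_rpow hp.ne'] using h

/-- Any positive C² solution of `u'' + u^(p-1) = λ u` on `ℝ` decaying (with its derivative)
at `±∞` attains its supremum, and the supremum equals `(pλ/2)^(1/(p-2))`. -/
theorem stmt_2 (p lam : ℝ) (hp : 2 < p) (hlam : 0 < lam)
    (u : ℝ → ℝ) (hu : ContDiff ℝ 2 u)
    (hpos : ∀ x, 0 < u x)
    (heq : ∀ x, deriv (deriv u) x + u x ^ (p - 1) = lam * u x)
    (htop : Tendsto u atTop (nhds 0))
    (hbot : Tendsto u atBot (nhds 0))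
    (htop' : Tendsto (deriv u) atTop (nhds 0))
    (hbot' : Tendsto (deriv u) atBot (nhds 0)) :
    ∃ x₀ : ℝ, (∀ x, u x ≤ u x₀) ∧ u x₀ = (p * lam / 2) ^ (1 / (p - 2)) := by
  have hp0 : 0 < p := by linarith
  obtain ⟨x₀, hmax⟩ := exists_forall_le_of_pos_of_tendsto_zero hu.continuous hpos htop hbot
  refine ⟨x₀, hmax, ?_⟩
  have hderiv : deriv u x₀ = 0 := IsLocalMax.deriv_eq_zero (Eventually.of_forall hmax)
  have henergy := energy_eq_zero hp0 hu hpos heq htop htop' x₀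
  have hsplit : u x₀ ^ p = u x₀ ^ (p - 2) * u x₀ ^ 2 := by
    rw [← Real.rpow_natCast, ← Real.rpow_add (hpos x₀)]
    norm_num
  have hkey : u x₀ ^ (p - 2) = p * lam / 2 := by
    rw [hderiv, hsplit] at henergy
    refine mul_right_cancel₀ (pow_pos (hpos x₀) 2).ne' ?_
    field_simp at henergy ⊢
    linarith
  rw [← hkey, one_div, Real.rpow_rpow_inv (hpos x₀).le (by linarith)]
end

section
/- Let p > 2 be real. Suppose u : ℝ → ℝ is twice continuously differentiable, u(x) > 0 for all x ∈ ℝ, u and u' are square-integrable on ℝ, and u''(x) + u(x)^(p−1) = λ·u(x) for all x ∈ ℝ, for some λ ∈ ℝ. Then λ > 0. -/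
/-- A differentiable concave function on `ℝ` lies below each of its tangent lines. -/
lemma ConcaveOn.le_tangent {f : ℝ → ℝ} (hf : ConcaveOn ℝ Set.univ f) {x : ℝ}
    (hfx : DifferentiableAt ℝ f x) (y : ℝ) : f y ≤ f x + deriv f x * (y - x) := by
  rcases lt_trichotomy x y with h | rfl | h
  · have := hf.slope_le_deriv (Set.mem_univ x) (Set.mem_univ y) h hfx
    rw [slope_def_field, div_le_iff₀ (sub_pos.2 h)] at this
    linarith
  · simp
  · have := hf.deriv_le_slope (Set.mem_univ y) (Set.mem_univ x) h hfx
    rw [slope_def_field, le_div_iff₀ (sub_pos.2 h)] at this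
    linarith

/-- A positive differentiable concave function on `ℝ` has vanishing derivative. -/
lemma ConcaveOn.deriv_eq_zero_of_pos {f : ℝ → ℝ} (hf : ConcaveOn ℝ Set.univ f)
    (hpos : ∀ x, 0 < f x) {x : ℝ} (hfx : DifferentiableAt ℝ f x) : deriv f x = 0 := by
  by_contra h
  have htangent := hf.le_tangent hfx (x - f x / deriv f x)
  have hzero : f x + deriv f x * (x - f x / deriv f x - x) = 0 := by field_simp; ring
  linarith [hpos (x - f x / deriv f x)]


open Real Set MeasureTheory Filter

/-- Every positive `H¹` (i.e. with `u` and `u'` square-integrable) C² solution of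
`u'' + u^(p-1) = λ u` on `ℝ` has a strictly positive Lagrange multiplier `λ`. -/
theorem stmt_11 (p lam : ℝ) (hp : 2 < p)
    (u : ℝ → ℝ) (hu : ContDiff ℝ 2 u)
    (hpos : ∀ x, 0 < u x)
    (hL2 : Integrable (fun x => u x ^ 2))
    (hL2' : Integrable (fun x => deriv u x ^ 2))
    (heq : ∀ x, deriv (deriv u) x + u x ^ (p - 1) = lam * u x) :
    0 < lam := by
  by_contra! hlam
  have hneg (x : ℝ) : deriv (deriv u) x < 0 := by
    have hpow := rpow_pos_of_pos (hpos x) (p - 1)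
    have hmul := mul_nonpos_of_nonpos_of_nonneg hlam (hpos x).le
    linarith [heq x]
  have hdiff : Differentiable ℝ u := hu.differentiable (by norm_num)
  have hanti : StrictAnti (deriv u) := strictAnti_of_deriv_neg hneg
  have hconc : ConcaveOn ℝ Set.univ u := hanti.antitone.concaveOn_univ_of_deriv hdiff
  have hzero (x : ℝ) : deriv u x = 0 := hconc.deriv_eq_zero_of_pos hpos (hdiff x)
  have hlt := hanti zero_lt_one
  rw [hzero, hzero] at hlt
  exact lt_irrefl _ hlt
end

section
/- Let p > 6 be real, β = (p−2)/(6−p), and μ > 0. Suppose λ₁ > 0 and λ₂ > 0 satisfy ∫_ℝ φ_{λ₁,p}(x)² dx = μ and ∫_ℝ φ_{λ₂,p}(x)² dx = 2μ. Then ∫_0^∞ φ_{λ₂,p}(x)² dx = μ, the half-line energy (1/2)·∫_0^∞ φ_{λ₂,p}'(x)² dx − (1/p)·∫_0^∞ φ_{λ₂,p}(x)^p dx equals (1/2)·E(φ_{λ₂,p}) = 2^(2β)·E(φ_{λ₁,p}), and since 2β < 0 this half-line energy is strictly smaller than E(φ_{λ₁,p}). -/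
open Real Set MeasureTheory Filter

/-- Powers of `1 / cosh` are integrable on the line. -/
lemma integrable_cosh_rpow_neg {r : ℝ} (hr : 0 < r) :
    Integrable fun x : ℝ ↦ Real.cosh x ^ (-r) := by
  have hcont : Continuous fun x : ℝ ↦ Real.cosh x ^ (-r) :=
    Real.continuous_cosh.rpow_const fun x ↦ Or.inl (Real.cosh_pos x).ne'
  have hbound : ∀ x y : ℝ, Real.exp y ≤ 2 * Real.cosh x →
      ‖Real.cosh x ^ (-r)‖ ≤ 2 ^ r * Real.exp (-r * y) := by
    intro x y h
    have hc := Real.cosh_pos x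
    rw [Real.norm_of_nonneg (Real.rpow_nonneg hc.le _)]
    calc Real.cosh x ^ (-r) ≤ (Real.exp y / 2) ^ (-r) :=
          Real.rpow_le_rpow_of_nonpos (by positivity) (by linarith) (by linarith)
      _ = 2 ^ r * Real.exp (-r * y) := by
          rw [Real.div_rpow (Real.exp_pos y).le zero_le_two, ← Real.exp_mul,
            Real.rpow_neg zero_le_two, div_inv_eq_mul]
          ring_nf
  rw [← integrableOn_univ, ← Iic_union_Ioi (a := (0 : ℝ))]
  refine IntegrableOn.union ?_ ?_
  · refine ((integrableOn_exp_mul_Iic hr 0).const_mul (2 ^ r)).mono'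
      hcont.aestronglyMeasurable (Eventually.of_forall fun x ↦ ?_)
    have := hbound x (-x) (by rw [Real.cosh_eq]; linarith [Real.exp_pos x])
    simpa using this
  · refine ((integrableOn_exp_mul_Ioi (neg_lt_zero.mpr hr) 0).const_mul (2 ^ r)).mono'
      hcont.aestronglyMeasurable (Eventually.of_forall fun x ↦ ?_)
    exact hbound x x (by rw [Real.cosh_eq]; linarith [Real.exp_pos (-x)])

lemma integral_cosh_rpow_neg_pos {r : ℝ} (hr : 0 < r) :
    0 < ∫ x : ℝ, Real.cosh x ^ (-r) := by
  have hpos : ∀ x : ℝ, 0 < Real.cosh x ^ (-r) := fun x ↦ Real.rpow_pos_of_pos (Real.cosh_pos x) _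
  rw [integral_pos_iff_support_of_nonneg (fun x ↦ (hpos x).le) (integrable_cosh_rpow_neg hr),
    Function.support_eq_univ fun x ↦ (hpos x).ne']
  simp

/-- The reduction formula for the integrals of powers of `1 / cosh`. -/
lemma integral_cosh_rpow_neg_reduction {r : ℝ} (hr : 0 < r) :
    r * (∫ x : ℝ, Real.cosh x ^ (-r)) = (r + 1) * ∫ x : ℝ, Real.cosh x ^ (-(r + 2)) := by
  have hI := integrable_cosh_rpow_neg hr
  have hJ := integrable_cosh_rpow_neg (r := r + 2) (by linarith)
  have hderiv : ∀ x : ℝ, HasDerivAt (fun y ↦ Real.sinh y * Real.cosh y ^ (-(r + 1)))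
      ((r + 1) * Real.cosh x ^ (-(r + 2)) - r * Real.cosh x ^ (-r)) x := by
    intro x
    have hc := Real.cosh_pos x
    have h := (Real.hasDerivAt_sinh x).mul
      ((Real.hasDerivAt_cosh x).rpow_const (p := -(r + 1)) (Or.inl hc.ne'))
    refine h.congr_deriv ?_
    have e1 : Real.cosh x ^ (-(r + 1)) = Real.cosh x ^ (-(r + 2)) * Real.cosh x := by
      rw [← Real.rpow_add_one hc.ne']; ring_nf
    have e0 : Real.cosh x ^ (-r) = Real.cosh x ^ (-(r + 2)) * Real.cosh x ^ 2 := by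
      rw [← Real.rpow_add_natCast hc.ne']; push_cast; ring_nf
    have e2 : -(r + 1) - 1 = -(r + 2) := by ring
    rw [e2, e1, e0]
    linear_combination -(r + 1) * Real.cosh x ^ (-(r + 2)) * Real.sinh_sq x
  have hint : Integrable fun y : ℝ ↦ Real.sinh y * Real.cosh y ^ (-(r + 1)) := by
    refine hI.mono' (Real.continuous_sinh.mul (Real.continuous_cosh.rpow_const
      fun x ↦ Or.inl (Real.cosh_pos x).ne')).aestronglyMeasurable (Eventually.of_forall fun x ↦ ?_)
    have hc := Real.cosh_pos x
    rw [norm_mul, Real.norm_of_nonneg (Real.rpow_nonneg hc.le _), Real.norm_eq_abs]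
    have e : Real.cosh x ^ (-r) = Real.cosh x * Real.cosh x ^ (-(r + 1)) := by
      rw [mul_comm, ← Real.rpow_add_one hc.ne']; ring_nf
    rw [e]
    gcongr
    exact abs_le_of_sq_le_sq (by rw [Real.cosh_sq]; linarith) hc.le
  have h := integral_eq_zero_of_hasDerivAt_of_integrable hderiv
    ((hJ.const_mul _).sub (hI.const_mul _)) hint
  rw [integral_sub (hJ.const_mul _) (hI.const_mul _), integral_const_mul, integral_const_mul] at h
  linarith

lemma integral_cosh_mul_rpow {a : ℝ} (ha : 0 < a) (r : ℝ) :
    ∫ x : ℝ, Real.cosh (a * x) ^ r = a⁻¹ * ∫ x : ℝ, Real.cosh x ^ r := by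
  rw [Measure.integral_comp_mul_left (fun x ↦ Real.cosh x ^ r), abs_of_pos (inv_pos.mpr ha),
    smul_eq_mul]

lemma integral_eq_two_mul_integral_Ioi_of_even {f : ℝ → ℝ} (hf : ∀ x, f (-x) = f x) :
    ∫ x, f x = 2 * ∫ x in Ioi (0 : ℝ), f x := by
  rw [← integral_comp_abs]
  congr 1 with x
  rcases abs_choice x with h | h <;> rw [h]
  exact (hf x).symm

/-- The soliton `φ_{λ,p}`. -/
noncomputable def soliton (p lam x : ℝ) : ℝ :=
  (p * lam / 2) ^ (1 / (p - 2)) * Real.cosh ((p - 2) / 2 * Real.sqrt lam * x) ^ (-(2 / (p - 2)))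

section Soliton

variable {p lam : ℝ}

lemma soliton_nonneg (hp : 2 < p) (hl : 0 < lam) (x : ℝ) : 0 ≤ soliton p lam x := by
  unfold soliton
  have := Real.cosh_pos ((p - 2) / 2 * Real.sqrt lam * x)
  positivity

lemma soliton_neg (x : ℝ) : soliton p lam (-x) = soliton p lam x := by
  simp [soliton]

lemma soliton_sq (hp : 2 < p) (hl : 0 < lam) (x : ℝ) :
    soliton p lam x ^ 2 = (p * lam / 2) ^ (2 / (p - 2)) *
      Real.cosh ((p - 2) / 2 * Real.sqrt lam * x) ^ (-(4 / (p - 2))) := by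
  have hc := Real.cosh_pos ((p - 2) / 2 * Real.sqrt lam * x)
  have hA : 0 ≤ p * lam / 2 := by positivity
  rw [soliton, mul_pow, ← Real.rpow_mul_natCast hA, ← Real.rpow_mul_natCast hc.le]
  push_cast
  ring_nf

lemma soliton_rpow (hp : 2 < p) (hl : 0 < lam) (x : ℝ) :
    soliton p lam x ^ p = (p * lam / 2) ^ (2 / (p - 2)) * (p * lam / 2) *
      Real.cosh ((p - 2) / 2 * Real.sqrt lam * x) ^ (-(4 / (p - 2) + 2)) := by
  have hc := Real.cosh_pos ((p - 2) / 2 * Real.sqrt lam * x)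
  have hA : 0 < p * lam / 2 := by positivity
  have hp2 : p - 2 ≠ 0 := by linarith
  rw [soliton, Real.mul_rpow (by positivity) (by positivity), ← Real.rpow_mul hA.le,
    ← Real.rpow_mul hc.le, ← Real.rpow_add_one hA.ne']
  congr 2 <;> · field_simp; ring

lemma deriv_soliton_sq (hp : 2 < p) (hl : 0 < lam) (x : ℝ) :
    deriv (soliton p lam) x ^ 2 = (p * lam / 2) ^ (2 / (p - 2)) * lam *
      (Real.cosh ((p - 2) / 2 * Real.sqrt lam * x) ^ (-(4 / (p - 2))) -
        Real.cosh ((p - 2) / 2 * Real.sqrt lam * x) ^ (-(4 / (p - 2) + 2))) := by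
  set a := (p - 2) / 2 * Real.sqrt lam with ha
  have hc := Real.cosh_pos (a * x)
  have hA : 0 ≤ p * lam / 2 := by positivity
  have hp2 : p - 2 ≠ 0 := by linarith
  have hd : HasDerivAt (soliton p lam) _ x :=
    ((((hasDerivAt_id x).const_mul a).cosh).rpow_const (p := -(2 / (p - 2)))
      (Or.inl hc.ne')).const_mul ((p * lam / 2) ^ (1 / (p - 2)))
  rw [hd.deriv]
  simp only [id, mul_one]
  have e1 : Real.cosh (a * x) ^ (-(4 / (p - 2))) =
      Real.cosh (a * x) ^ (-(4 / (p - 2) + 2)) * Real.cosh (a * x) ^ 2 := by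
    rw [← Real.rpow_add_natCast hc.ne']; push_cast; ring_nf
  have e2 : (Real.cosh (a * x) ^ (-(2 / (p - 2)) - 1)) ^ 2 =
      Real.cosh (a * x) ^ (-(4 / (p - 2) + 2)) := by
    rw [← Real.rpow_mul_natCast hc.le]; push_cast; ring_nf
  have e3 : ((p * lam / 2) ^ (1 / (p - 2))) ^ 2 = (p * lam / 2) ^ (2 / (p - 2)) := by
    rw [← Real.rpow_mul_natCast hA]; push_cast; ring_nf
  have e4 : (a * (2 / (p - 2))) ^ 2 = lam := by
    rw [show a * (2 / (p - 2)) = Real.sqrt lam by rw [ha]; field_simp, Real.sq_sqrt hl.le]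
  rw [e1, ← e2, ← e3]
  calc _ = ((p * lam / 2) ^ (1 / (p - 2))) ^ 2 * (a * (2 / (p - 2))) ^ 2 *
        ((Real.cosh (a * x) ^ (-(2 / (p - 2)) - 1)) ^ 2 * Real.sinh (a * x) ^ 2) := by ring
    _ = _ := by rw [e4, Real.sinh_sq]; ring

lemma integral_soliton_sq (hp : 2 < p) (hl : 0 < lam) :
    ∫ x, soliton p lam x ^ 2 = (p * lam / 2) ^ (2 / (p - 2)) *
      (((p - 2) / 2 * Real.sqrt lam)⁻¹ * ∫ x : ℝ, Real.cosh x ^ (-(4 / (p - 2)))) := by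
  have ha : 0 < (p - 2) / 2 * Real.sqrt lam := mul_pos (by linarith) (Real.sqrt_pos.mpr hl)
  simp_rw [soliton_sq hp hl]
  rw [integral_const_mul, integral_cosh_mul_rpow ha]

/-- The energy of a soliton is proportional to its mass times its frequency. -/
lemma soliton_energy (hp : 2 < p) (hl : 0 < lam) :
    1 / 2 * (∫ x, deriv (soliton p lam) x ^ 2) - 1 / p * (∫ x, |soliton p lam x| ^ p) =
      (p - 6) / (2 * (p + 2)) * lam * ∫ x, soliton p lam x ^ 2 := by
  have ha : 0 < (p - 2) / 2 * Real.sqrt lam := mul_pos (by linarith) (Real.sqrt_pos.mpr hl)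
  have hp2 : 0 < p - 2 := by linarith
  have hr : 0 < 4 / (p - 2) := by positivity
  have hI := (integrable_cosh_rpow_neg hr).comp_mul_left' ha.ne'
  have hJ := (integrable_cosh_rpow_neg (r := 4 / (p - 2) + 2) (by linarith)).comp_mul_left' ha.ne'
  have hred := integral_cosh_rpow_neg_reduction hr
  simp_rw [abs_of_nonneg (soliton_nonneg hp hl _), integral_soliton_sq hp hl, soliton_rpow hp hl,
    deriv_soliton_sq hp hl]
  rw [integral_const_mul, integral_const_mul, integral_sub hI hJ, integral_cosh_mul_rpow ha,
    integral_cosh_mul_rpow ha]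
  have hJ' : ∫ x : ℝ, Real.cosh x ^ (-(4 / (p - 2) + 2)) =
      4 / (p + 2) * ∫ x : ℝ, Real.cosh x ^ (-(4 / (p - 2))) := by
    have : p + 2 ≠ 0 := by linarith
    field_simp at hred ⊢
    linarith
  rw [hJ']
  have : p + 2 ≠ 0 := by linarith
  have : p ≠ 0 := by linarith
  generalize ((p - 2) / 2 * Real.sqrt lam)⁻¹ = b
  generalize (p * lam / 2) ^ (2 / (p - 2)) = A
  field_simp
  ring

/-- The half-line energy of a soliton is half of its energy on the line. -/
lemma soliton_halfLine_energy (hp : 2 < p) (hl : 0 < lam) :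
    1 / 2 * (∫ x in Ioi (0 : ℝ), deriv (soliton p lam) x ^ 2) -
        1 / p * (∫ x in Ioi (0 : ℝ), soliton p lam x ^ p) =
      1 / 2 * (1 / 2 * (∫ x, deriv (soliton p lam) x ^ 2) -
        1 / p * (∫ x, |soliton p lam x| ^ p)) := by
  simp_rw [abs_of_nonneg (soliton_nonneg hp hl _)]
  rw [integral_eq_two_mul_integral_Ioi_of_even (f := fun x ↦ deriv (soliton p lam) x ^ 2),
    integral_eq_two_mul_integral_Ioi_of_even (f := fun x ↦ soliton p lam x ^ p)]
  · ring
  · simp [soliton_neg]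
  · intro x
    simp [deriv_soliton_sq hp hl]

/-- Doubling the mass multiplies the frequency by `2 ^ (2 * (p - 2) / (6 - p))`. -/
lemma frequency_eq_of_mass_eq_two_mul {lam' : ℝ} (hp : 2 < p) (hp6 : p ≠ 6) (hl : 0 < lam)
    (hl' : 0 < lam')
    (h : ∫ x, soliton p lam' x ^ 2 = 2 * ∫ x, soliton p lam x ^ 2) :
    lam' = 2 ^ (2 * ((p - 2) / (6 - p))) * lam := by
  have hp2 : 0 < p - 2 := by linarith
  have h6 : 6 - p ≠ 0 := sub_ne_zero.mpr hp6.symm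
  have hC := integral_cosh_rpow_neg_pos (r := 4 / (p - 2)) (by positivity)
  have hmass : ∀ l : ℝ, 0 < l → ∫ x, soliton p l x ^ 2 =
      ((p / 2) ^ (2 / (p - 2)) * ((p - 2) / 2)⁻¹ *
        ∫ x : ℝ, Real.cosh x ^ (-(4 / (p - 2)))) * l ^ ((6 - p) / (2 * (p - 2))) := by
    intro l hl
    have e : l ^ ((6 - p) / (2 * (p - 2))) = l ^ (2 / (p - 2)) * (Real.sqrt l)⁻¹ := by
      rw [Real.sqrt_eq_rpow, ← Real.rpow_neg hl.le, ← Real.rpow_add hl]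
      congr 1
      field_simp
      ring
    rw [integral_soliton_sq hp hl, e, mul_div_right_comm, Real.mul_rpow (by positivity) hl.le,
      mul_inv]
    ring
  rw [hmass _ hl, hmass _ hl', mul_left_comm] at h
  have h := mul_left_cancel₀ (by positivity) h
  have hexp : (6 - p) / (2 * (p - 2)) * (2 * ((p - 2) / (6 - p))) = 1 := by field_simp
  have := congrArg (fun t : ℝ ↦ t ^ (2 * ((p - 2) / (6 - p)))) h
  simpa only [Real.mul_rpow zero_le_two (Real.rpow_nonneg hl.le _), ← Real.rpow_mul hl.le,
    ← Real.rpow_mul hl'.le, hexp, Real.rpow_one] using this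

end Soliton

/-- Comparison of the half-soliton on the half-line with the soliton on the line:
if `∫_ℝ φ_{λ₁,p}² = μ` and `∫_ℝ φ_{λ₂,p}² = 2μ`, then `∫_0^∞ φ_{λ₂,p}² = μ`, the
half-line energy of `φ_{λ₂,p}` equals `(1/2) E(φ_{λ₂,p}) = 2^(2β) E(φ_{λ₁,p})`, and
(since `2β < 0`) is strictly smaller than `E(φ_{λ₁,p})`. -/
theorem stmt_12 (p β μ lam₁ lam₂ : ℝ) (hp : 6 < p) (hβ : β = (p - 2) / (6 - p))
    (hμ : 0 < μ) (hl1 : 0 < lam₁) (hl2 : 0 < lam₂)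
    (φ₁ φ₂ : ℝ → ℝ)
    (hφ₁ : ∀ x, φ₁ x = (p * lam₁ / 2) ^ (1 / (p - 2)) *
      Real.cosh ((p - 2) / 2 * Real.sqrt lam₁ * x) ^ (-(2 / (p - 2))))
    (hφ₂ : ∀ x, φ₂ x = (p * lam₂ / 2) ^ (1 / (p - 2)) *
      Real.cosh ((p - 2) / 2 * Real.sqrt lam₂ * x) ^ (-(2 / (p - 2))))
    (hm1 : (∫ x, φ₁ x ^ 2) = μ) (hm2 : (∫ x, φ₂ x ^ 2) = 2 * μ) :
    (∫ x in Ioi (0 : ℝ), φ₂ x ^ 2) = μ ∧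
    (1 / 2 * (∫ x in Ioi (0 : ℝ), deriv φ₂ x ^ 2) - 1 / p * (∫ x in Ioi (0 : ℝ), φ₂ x ^ p)
      = 1 / 2 * (1 / 2 * (∫ x, deriv φ₂ x ^ 2) - 1 / p * (∫ x, |φ₂ x| ^ p))) ∧
    (1 / 2 * (∫ x in Ioi (0 : ℝ), deriv φ₂ x ^ 2) - 1 / p * (∫ x in Ioi (0 : ℝ), φ₂ x ^ p)
      = (2 : ℝ) ^ (2 * β) * (1 / 2 * (∫ x, deriv φ₁ x ^ 2) - 1 / p * (∫ x, |φ₁ x| ^ p))) ∧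
    2 * β < 0 ∧
    (1 / 2 * (∫ x in Ioi (0 : ℝ), deriv φ₂ x ^ 2) - 1 / p * (∫ x in Ioi (0 : ℝ), φ₂ x ^ p)
      < 1 / 2 * (∫ x, deriv φ₁ x ^ 2) - 1 / p * (∫ x, |φ₁ x| ^ p)) := by
  obtain rfl : φ₁ = soliton p lam₁ := funext hφ₁
  obtain rfl : φ₂ = soliton p lam₂ := funext hφ₂
  have hp2 : 2 < p := by linarith
  have hfreq := frequency_eq_of_mass_eq_two_mul hp2 hp.ne' hl1 hl2 (by rw [hm1, hm2])
  rw [← hβ] at hfreq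
  have hβ0 : 2 * β < 0 := by
    have : β < 0 := by rw [hβ]; exact div_neg_of_pos_of_neg (by linarith) (by linarith)
    linarith
  have hE : 0 < (p - 6) / (2 * (p + 2)) * lam₁ * μ := by
    have : 0 < p - 6 := by linarith
    have : 0 < p + 2 := by linarith
    positivity
  have hlt : (2 : ℝ) ^ (2 * β) < 1 := Real.rpow_lt_one_of_one_lt_of_neg one_lt_two hβ0
  have heq : 1 / 2 * (∫ x in Ioi (0 : ℝ), deriv (soliton p lam₂) x ^ 2) -
      1 / p * (∫ x in Ioi (0 : ℝ), soliton p lam₂ x ^ p) =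
      (2 : ℝ) ^ (2 * β) * (1 / 2 * (∫ x, deriv (soliton p lam₁) x ^ 2) -
        1 / p * (∫ x, |soliton p lam₁ x| ^ p)) := by
    rw [soliton_halfLine_energy hp2 hl2, soliton_energy hp2 hl2, soliton_energy hp2 hl1, hm1, hm2]
    nth_rewrite 1 [hfreq]
    ring
  refine ⟨?_, soliton_halfLine_energy hp2 hl2, heq, hβ0, ?_⟩
  · rw [integral_eq_two_mul_integral_Ioi_of_even (by simp [soliton_neg])] at hm2
    linarith
  · rw [heq, soliton_energy hp2 hl1, hm1]
    exact mul_lt_of_lt_one_left hE hlt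
end

section
/- Let p > 6 be real, λ > 0, and write φ = φ_{λ,p}. For s > 0 define u_s(x) := √s·φ(s·x). Then: (i) ∫_ℝ u_s(x)² dx = ∫_ℝ φ(x)² dx for every s > 0; (ii) E(u_s) = ((p−2)/(4p))·s²·∫_ℝ φ(x)^p dx − (s^(p/2−1)/p)·∫_ℝ φ(x)^p dx; (iii) the function s ↦ E(u_s) attains its maximum on (0,∞) uniquely at s = 1, with maximum value E(φ); (iv) E(u_s) < 0 if and only if s > ((p−2)/4)^(2/(p−6)). -/
open Real Set MeasureTheory Filter

lemma integrable_exp_neg_mul_abs {a : ℝ} (ha : 0 < a) :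
    Integrable fun x : ℝ => Real.exp (-a * |x|) := by
  rw [← integrableOn_univ, ← Set.Iic_union_Ioi (a := (0 : ℝ))]
  refine IntegrableOn.union ?_ ?_
  · refine (integrableOn_exp_mul_Iic ha 0).congr_fun (fun x hx => ?_) measurableSet_Iic
    simp only [abs_of_nonpos (Set.mem_Iic.1 hx), neg_mul_neg]
  · refine (exp_neg_integrableOn_Ioi 0 ha).congr_fun (fun x hx => ?_) measurableSet_Ioi
    simp only [abs_of_pos (Set.mem_Ioi.1 hx)]

lemma integrable_cosh_mul_rpow_neg {k c : ℝ} (hk : 0 < k) (hc : 0 < c) :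
    Integrable fun x : ℝ => Real.cosh (k * x) ^ (-c) := by
  have hexp : Integrable fun x : ℝ => 2 ^ c * Real.exp (-(c * k) * |x|) :=
    (integrable_exp_neg_mul_abs (mul_pos hc hk)).const_mul _
  have hcont : Continuous fun x : ℝ => Real.cosh (k * x) ^ (-c) :=
    (Real.continuous_cosh.comp (continuous_const.mul continuous_id)).rpow_const
      fun x => Or.inl (Real.cosh_pos _).ne'
  refine hexp.mono' hcont.aestronglyMeasurable (ae_of_all _ fun x => ?_)
  rw [Real.norm_of_nonneg (rpow_nonneg (Real.cosh_pos _).le _)]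
  have hle : Real.exp (k * |x|) / 2 ≤ Real.cosh (k * x) := by
    rw [← Real.cosh_abs (k * x), abs_mul, abs_of_pos hk, Real.cosh_eq]
    linarith [Real.exp_pos (-(k * |x|))]
  calc Real.cosh (k * x) ^ (-c) ≤ (Real.exp (k * |x|) / 2) ^ (-c) :=
        rpow_le_rpow_of_nonpos (by positivity) hle (by linarith)
    _ = 2 ^ c * Real.exp (-(c * k) * |x|) := by
        rw [div_rpow (Real.exp_pos _).le (by norm_num), ← Real.exp_mul,
          rpow_neg (by norm_num : (0 : ℝ) ≤ 2), div_inv_eq_mul, mul_comm]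
        congr 2
        ring

lemma integral_cosh_mul_rpow_neg_pos {k c : ℝ} (hk : 0 < k) (hc : 0 < c) :
    0 < ∫ x : ℝ, Real.cosh (k * x) ^ (-c) := by
  rw [integral_pos_iff_support_of_nonneg (fun x => rpow_nonneg (Real.cosh_pos _).le _)
    (integrable_cosh_mul_rpow_neg hk hc)]
  have hsupp : Function.support (fun x : ℝ => Real.cosh (k * x) ^ (-c)) = Set.univ :=
    Set.eq_univ_of_forall fun x => (rpow_pos_of_pos (Real.cosh_pos _) _).ne'
  simp [hsupp]

lemma sinh_sq_mul_cosh_rpow (y c : ℝ) :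
    Real.sinh y ^ 2 * Real.cosh y ^ (-(c + 2)) =
      Real.cosh y ^ (-c) - Real.cosh y ^ (-(c + 2)) := by
  have h : Real.cosh y ^ (-c) = Real.cosh y ^ (-(c + 2)) * Real.cosh y ^ 2 := by
    rw [← Real.rpow_natCast, ← rpow_add (Real.cosh_pos y)]
    congr 1
    push_cast
    ring
  rw [h, Real.cosh_sq]
  ring

lemma hasDerivAt_cosh_mul_rpow (k r x : ℝ) :
    HasDerivAt (fun x : ℝ => Real.cosh (k * x) ^ r)
      (r * k * (Real.sinh (k * x) * Real.cosh (k * x) ^ (r - 1))) x := by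
  have h := (((hasDerivAt_id x).const_mul k).cosh).rpow_const (p := r)
    (Or.inl (Real.cosh_pos _).ne')
  refine h.congr_deriv ?_
  simp only [id]
  ring

/-- The reduction formula for integrals of powers of the hyperbolic secant. -/
lemma integral_cosh_mul_rpow_neg_reduction {k c : ℝ} (hk : 0 < k) (hc : 0 < c) :
    c * (∫ x : ℝ, Real.cosh (k * x) ^ (-c)) =
      (c + 1) * ∫ x : ℝ, Real.cosh (k * x) ^ (-(c + 2)) := by
  have hi := integrable_cosh_mul_rpow_neg hk hc
  have hi2 := integrable_cosh_mul_rpow_neg hk (by linarith : 0 < c + 2)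
  have hder : ∀ x : ℝ, HasDerivAt
      (fun x : ℝ => Real.sinh (k * x) * Real.cosh (k * x) ^ (-(c + 1)))
      (k * ((c + 1) * Real.cosh (k * x) ^ (-(c + 2)) - c * Real.cosh (k * x) ^ (-c))) x := by
    intro x
    have h := (((hasDerivAt_id x).const_mul k).sinh).mul
      (hasDerivAt_cosh_mul_rpow k (-(c + 1)) x)
    refine h.congr_deriv ?_
    have h1 : Real.cosh (k * x) * Real.cosh (k * x) ^ (-(c + 1)) = Real.cosh (k * x) ^ (-c) := by
      rw [← rpow_one_add' (Real.cosh_pos _).le (by linarith)]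
      congr 1
      ring
    have h2 : -(c + 1) - 1 = -(c + 2) := by ring
    simp only [id, h2]
    linear_combination k * h1 - (c + 1) * k * sinh_sq_mul_cosh_rpow (k * x) c
  have hF : Integrable fun x : ℝ => Real.sinh (k * x) * Real.cosh (k * x) ^ (-(c + 1)) := by
    refine hi.mono' (continuous_iff_continuousAt.2
      fun x => (hder x).continuousAt).aestronglyMeasurable (ae_of_all _ fun x => ?_)
    have hs : |Real.sinh (k * x)| ≤ Real.cosh (k * x) :=
      abs_le_of_sq_le_sq (by nlinarith [Real.cosh_sq (k * x)]) (Real.cosh_pos _).le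
    rw [norm_mul, Real.norm_eq_abs, Real.norm_of_nonneg (rpow_nonneg (Real.cosh_pos _).le _)]
    calc _ ≤ Real.cosh (k * x) * Real.cosh (k * x) ^ (-(c + 1)) :=
          mul_le_mul_of_nonneg_right hs (rpow_nonneg (Real.cosh_pos _).le _)
      _ = Real.cosh (k * x) ^ (-c) := by
          rw [← rpow_one_add' (Real.cosh_pos _).le (by linarith)]
          congr 1
          ring
  have h0 := integral_eq_zero_of_hasDerivAt_of_integrable hder
    (((hi2.const_mul (c + 1)).sub (hi.const_mul c)).const_mul k) hF
  rw [integral_const_mul, integral_sub (hi2.const_mul _) (hi.const_mul _), integral_const_mul,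
    integral_const_mul] at h0
  have := (mul_eq_zero.1 h0).resolve_left hk.ne'
  linarith

lemma soliton_pohozaev {p lam : ℝ} (hp : 2 < p) (hlam : 0 < lam) {φ : ℝ → ℝ}
    (hφ : ∀ x, φ x = (p * lam / 2) ^ (1 / (p - 2)) *
      Real.cosh ((p - 2) / 2 * Real.sqrt lam * x) ^ (-(2 / (p - 2)))) :
    (∫ x, deriv φ x ^ 2) = (p - 2) / (2 * p) * (∫ x, φ x ^ p) ∧ 0 < ∫ x, φ x ^ p := by
  have hp2 : 0 < p - 2 := by linarith
  obtain ⟨k, hk⟩ : ∃ k, k = (p - 2) / 2 * Real.sqrt lam := ⟨_, rfl⟩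
  obtain ⟨A, hA⟩ : ∃ A, A = (p * lam / 2) ^ (1 / (p - 2)) := ⟨_, rfl⟩
  obtain ⟨b, hb⟩ : ∃ b, b = 2 / (p - 2) := ⟨_, rfl⟩
  have hk0 : 0 < k := by rw [hk]; positivity
  have hb0 : 0 < b := by rw [hb]; positivity
  have hbase : 0 < p * lam / 2 := by positivity
  have hA0 : 0 < A := by rw [hA]; positivity
  have hbp : b * (p - 2) = 2 := by rw [hb]; field_simp
  have hbk : b ^ 2 * k ^ 2 = lam := by
    rw [hk, mul_pow, Real.sq_sqrt hlam.le]
    linear_combination (lam / 4) * (b * (p - 2) + 2) * hbp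
  have hAp : A ^ p = A ^ 2 * (p * lam / 2) := by
    have h : A ^ (p - 2) = p * lam / 2 := by
      rw [hA, ← rpow_mul hbase.le, one_div_mul_cancel hp2.ne', rpow_one]
    rw [← h, ← Real.rpow_natCast, ← rpow_add hA0]
    congr 1
    push_cast
    ring
  rw [← hk, ← hA, ← hb] at hφ
  have hφp : ∀ x, φ x ^ p = A ^ p * Real.cosh (k * x) ^ (-(2 * b + 2)) := by
    intro x
    rw [hφ, mul_rpow hA0.le (rpow_nonneg (Real.cosh_pos _).le _), ← rpow_mul (Real.cosh_pos _).le]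
    congr 2
    linarith
  have hdφ : ∀ x, deriv φ x ^ 2 = A ^ 2 * lam *
      (Real.cosh (k * x) ^ (-(2 * b)) - Real.cosh (k * x) ^ (-(2 * b + 2))) := by
    intro x
    have hd : HasDerivAt φ
        (A * (-b * k * (Real.sinh (k * x) * Real.cosh (k * x) ^ (-b - 1)))) x := by
      rw [funext hφ]
      exact (hasDerivAt_cosh_mul_rpow k (-b) x).const_mul A
    have hsq : (Real.cosh (k * x) ^ (-b - 1)) ^ 2 = Real.cosh (k * x) ^ (-(2 * b + 2)) := by
      rw [← Real.rpow_natCast, ← rpow_mul (Real.cosh_pos _).le]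
      congr 1
      push_cast
      ring
    rw [hd.deriv, ← sinh_sq_mul_cosh_rpow, ← hsq, ← hbk]
    ring
  have hi := integrable_cosh_mul_rpow_neg hk0 (by positivity : 0 < 2 * b)
  have hi2 := integrable_cosh_mul_rpow_neg hk0 (by positivity : 0 < 2 * b + 2)
  have hpos := integral_cosh_mul_rpow_neg_pos hk0 (by positivity : 0 < 2 * b + 2)
  have hred := integral_cosh_mul_rpow_neg_reduction hk0 (by positivity : 0 < 2 * b)
  simp only [hφp, hdφ]
  rw [integral_const_mul, integral_const_mul, integral_sub hi hi2]
  refine ⟨?_, by positivity⟩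
  rw [hAp]
  have hdiff : (∫ x : ℝ, Real.cosh (k * x) ^ (-(2 * b))) -
      (∫ x : ℝ, Real.cosh (k * x) ^ (-(2 * b + 2))) =
      (p - 2) / 4 * ∫ x : ℝ, Real.cosh (k * x) ^ (-(2 * b + 2)) := by
    refine mul_left_cancel₀ (by positivity : 2 * b ≠ 0) ?_
    linear_combination hred - (1 / 2) * (∫ x : ℝ, Real.cosh (k * x) ^ (-(2 * b + 2))) * hbp
  rw [hdiff]
  field_simp
  ring

lemma fibering_lt_of_ne_one {p s : ℝ} (hp : 6 < p) (hs : 0 < s) (hs1 : s ≠ 1) :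
    (p - 2) / 4 * s ^ 2 - s ^ (p / 2 - 1) < (p - 2) / 4 - 1 := by
  have h := one_add_mul_self_lt_rpow_one_add (s := s ^ 2 - 1) (p := (p - 2) / 4)
    (by nlinarith [sq_nonneg s])
    (fun h => hs1 ((sq_eq_sq₀ hs.le zero_le_one).1 (by linarith))) (by linarith)
  have h2 : (1 + (s ^ 2 - 1)) ^ ((p - 2) / 4) = s ^ (p / 2 - 1) := by
    rw [add_sub_cancel, ← Real.rpow_natCast, ← rpow_mul hs.le]
    congr 1
    push_cast
    ring
  linarith

lemma fibering_neg_iff {p s : ℝ} (hp : 6 < p) (hs : 0 < s) :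
    (p - 2) / 4 * s ^ 2 - s ^ (p / 2 - 1) < 0 ↔ ((p - 2) / 4) ^ (2 / (p - 6)) < s := by
  have hp6 : 0 < p - 6 := by linarith
  have hq : 0 < (p - 2) / 4 := by linarith
  have h : s ^ (p / 2 - 1) = s ^ ((p - 6) / 2) * s ^ 2 := by
    rw [← Real.rpow_natCast, ← rpow_add hs]
    congr 1
    push_cast
    ring
  rw [h, sub_neg, mul_lt_mul_iff_left₀ (by positivity),
    ← rpow_lt_rpow_iff (by positivity) hs.le (by positivity : 0 < (p - 6) / 2),
    ← rpow_mul hq.le]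
  have h1 : 2 / (p - 6) * ((p - 6) / 2) = 1 := by field_simp
  rw [h1, rpow_one]

/-- The mass-preserving fibering family `u_s(x) = √s φ(sx)` along the soliton `φ = φ_{λ,p}`,
`p > 6`: (i) the mass is independent of `s`; (ii) explicit energy formula;
(iii) `s ↦ E(u_s)` attains its maximum on `(0,∞)` uniquely at `s = 1` with value `E(φ)`;
(iv) `E(u_s) < 0` iff `s > ((p-2)/4)^(2/(p-6))`. -/
theorem stmt_15 (p lam : ℝ) (hp : 6 < p) (hlam : 0 < lam)
    (φ : ℝ → ℝ)
    (hφ : ∀ x, φ x = (p * lam / 2) ^ (1 / (p - 2)) *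
      Real.cosh ((p - 2) / 2 * Real.sqrt lam * x) ^ (-(2 / (p - 2))))
    (u : ℝ → ℝ → ℝ) (hu : ∀ s x, u s x = Real.sqrt s * φ (s * x))
    (Ener : (ℝ → ℝ) → ℝ)
    (hEner : ∀ w : ℝ → ℝ, Ener w = 1 / 2 * (∫ x, deriv w x ^ 2) - 1 / p * ∫ x, |w x| ^ p) :
    (∀ s : ℝ, 0 < s → (∫ x, u s x ^ 2) = ∫ x, φ x ^ 2) ∧
    (∀ s : ℝ, 0 < s → Ener (u s)
      = (p - 2) / (4 * p) * s ^ 2 * (∫ x, φ x ^ p)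
        - s ^ (p / 2 - 1) / p * (∫ x, φ x ^ p)) ∧
    (Ener (u 1) = Ener φ ∧ ∀ s : ℝ, 0 < s → s ≠ 1 → Ener (u s) < Ener (u 1)) ∧
    (∀ s : ℝ, 0 < s → (Ener (u s) < 0 ↔ ((p - 2) / 4) ^ (2 / (p - 6)) < s)) := by
  have hp0 : 0 < p := by linarith
  obtain ⟨hpoh, hpos⟩ := soliton_pohozaev (by linarith : 2 < p) hlam hφ
  have hφ0 : ∀ x, 0 ≤ φ x := fun x => by
    rw [hφ]
    exact mul_nonneg (rpow_nonneg (by positivity) _) (rpow_nonneg (Real.cosh_pos _).le _)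
  have hscale : ∀ s : ℝ, 0 < s → ∀ g : ℝ → ℝ, (∫ x, g (s * x)) = s⁻¹ * ∫ x, g x := by
    intro s hs g
    rw [Measure.integral_comp_mul_left, abs_of_pos (inv_pos.2 hs), smul_eq_mul]
  have hE : ∀ s : ℝ, 0 < s → Ener (u s)
      = (p - 2) / (4 * p) * s ^ 2 * (∫ x, φ x ^ p)
        - s ^ (p / 2 - 1) / p * (∫ x, φ x ^ p) := by
    intro s hs
    have hd : ∀ x, deriv (u s) x ^ 2 = s ^ 3 * (fun y => deriv φ y ^ 2) (s * x) := by
      intro x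
      rw [funext (hu s), deriv_const_mul_field, deriv_comp_mul_left, smul_eq_mul, mul_pow,
        Real.sq_sqrt hs.le]
      ring
    have hw : ∀ x, |u s x| ^ p = s ^ (p / 2) * (fun y => φ y ^ p) (s * x) := by
      intro x
      rw [hu, abs_of_nonneg (mul_nonneg (Real.sqrt_nonneg _) (hφ0 _)),
        mul_rpow (Real.sqrt_nonneg _) (hφ0 _), Real.sqrt_eq_rpow, ← rpow_mul hs.le]
      congr 2
      ring
    rw [hEner]
    simp only [hd, hw]
    rw [integral_const_mul, integral_const_mul, hscale s hs fun y => deriv φ y ^ 2,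
      hscale s hs fun y => φ y ^ p, hpoh, rpow_sub_one hs.ne']
    field_simp
    ring
  have hE' : ∀ s : ℝ, 0 < s → Ener (u s)
      = (∫ x, φ x ^ p) / p * ((p - 2) / 4 * s ^ 2 - s ^ (p / 2 - 1)) := by
    intro s hs
    rw [hE s hs]
    field_simp
  have hJ : 0 < (∫ x, φ x ^ p) / p := div_pos hpos hp0
  refine ⟨fun s hs => ?_, hE, ⟨?_, fun s hs hs1 => ?_⟩, fun s hs => ?_⟩
  · have hm : ∀ x, u s x ^ 2 = s * (fun y => φ y ^ 2) (s * x) := by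
      intro x
      rw [hu, mul_pow, Real.sq_sqrt hs.le]
    simp only [hm]
    rw [integral_const_mul, hscale s hs fun y => φ y ^ 2, mul_inv_cancel_left₀ hs.ne']
  · congr 1
    funext x
    simp [hu]
  · rw [hE' s hs, hE' 1 one_pos, one_rpow, one_pow, mul_one]
    exact mul_lt_mul_of_pos_left (fibering_lt_of_ne_one hp hs hs1) hJ
  · rw [hE' s hs, ← fibering_neg_iff hp hs, mul_neg_iff]
    constructor
    · rintro (h | h)
      · exact h.2
      · exact absurd h.1 hJ.not_gt
    · exact fun h => Or.inl ⟨hJ, h⟩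
end

section
/- Let p > 6 be real and β = (p−2)/(6−p), so that 2β+1 < 0. Then there exists a constant c > 1, depending only on p, such that for every μ > 0 and every m with 0 < m < μ one has (μ−m)^(2β+1) + 2^(2β−1)·m^(2β+1) ≥ c·μ^(2β+1). -/
open Real Set MeasureTheory Filter

/-- Quantitative strict superadditivity in the supercritical regime: for `p > 6` and
`β = (p-2)/(6-p)` (so `2β+1 < 0`) there is `c > 1` depending only on `p` with
`(μ-m)^(2β+1) + 2^(2β-1) m^(2β+1) ≥ c μ^(2β+1)` for all `0 < m < μ`. -/
theorem stmt_16 (p β : ℝ) (hp : 6 < p) (hβ : β = (p - 2) / (6 - p)) :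
    2 * β + 1 < 0 ∧
    ∃ c : ℝ, 1 < c ∧ ∀ μ m : ℝ, 0 < m → m < μ →
      c * μ ^ (2 * β + 1) ≤ (μ - m) ^ (2 * β + 1) + (2 : ℝ) ^ (2 * β - 1) * m ^ (2 * β + 1) := by
  have hs : 2 * β + 1 < -1 := by
    have h : β < -1 := by
      rw [hβ, div_lt_iff_of_neg (by linarith)]
      linarith
    linarith
  refine ⟨by linarith, 5 / 4, by norm_num, fun μ m hm hmμ => ?_⟩
  have hμ : 0 < μ := hm.trans hmμ
  have hpow : 0 < μ ^ (2 * β + 1) := rpow_pos_of_pos hμ _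
  have hhalf : (μ / 2) ^ (2 * β + 1) = μ ^ (2 * β + 1) * (2 : ℝ) ^ (-(2 * β + 1)) := by
    rw [div_rpow hμ.le zero_le_two, rpow_neg zero_le_two, div_eq_mul_inv]
  rcases le_total m (μ / 2) with h | h
  · have h₁ : μ ^ (2 * β + 1) ≤ (μ - m) ^ (2 * β + 1) :=
      rpow_le_rpow_of_nonpos (by linarith) (by linarith) (by linarith)
    have h₂ : (μ / 2) ^ (2 * β + 1) ≤ m ^ (2 * β + 1) :=
      rpow_le_rpow_of_nonpos hm h (by linarith)
    have hquarter : (2 : ℝ) ^ (2 * β - 1) * (2 : ℝ) ^ (-(2 * β + 1)) = 1 / 4 := by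
      rw [← rpow_add zero_lt_two, show 2 * β - 1 + -(2 * β + 1) = -(2 : ℝ) by ring,
        rpow_neg zero_le_two, rpow_two]
      norm_num
    have h₃ : 1 / 4 * μ ^ (2 * β + 1) ≤ (2 : ℝ) ^ (2 * β - 1) * m ^ (2 * β + 1) :=
      calc 1 / 4 * μ ^ (2 * β + 1) = (2 : ℝ) ^ (2 * β - 1) * (μ / 2) ^ (2 * β + 1) := by
            rw [hhalf, ← hquarter]
            ring
        _ ≤ _ := by gcongr
    linarith
  · have h₁ : (μ / 2) ^ (2 * β + 1) ≤ (μ - m) ^ (2 * β + 1) :=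
      rpow_le_rpow_of_nonpos (by linarith) (by linarith) (by linarith)
    have h₂ : (2 : ℝ) ≤ (2 : ℝ) ^ (-(2 * β + 1)) :=
      self_le_rpow_of_one_le one_le_two (by linarith)
    have h₃ : 0 < (2 : ℝ) ^ (2 * β - 1) * m ^ (2 * β + 1) := by positivity
    rw [hhalf] at h₁
    nlinarith
end

section
/- Let p > 6 be real and m > 0. Then there exists μ_m > 0 such that: whenever 0 < μ ≤ μ_m and u : ℝ → ℝ is twice continuously differentiable with u(x) > 0 for all x, u and u' square-integrable on ℝ, ∫_ℝ u(x)² dx = μ, and u''(x) + u(x)^(p−1) = λ·u(x) on ℝ for some λ ∈ ℝ, then λ ≥ m. -/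
open Real Set MeasureTheory Filter

/-- A function with integrable square, whose derivative also has integrable square, tends to zero
at both ends of the line. -/
theorem tendsto_zero_of_sq_integrable {u : ℝ → ℝ} (hu : Differentiable ℝ u)
    (hu' : Continuous (deriv u)) (hi : Integrable (fun x => u x ^ 2))
    (hi' : Integrable (fun x => deriv u x ^ 2)) :
    Integrable (fun x => 2 * u x * deriv u x) ∧
      Tendsto u atTop (nhds 0) ∧ Tendsto u atBot (nhds 0) := by
  have hd : ∀ x, HasDerivAt (fun x => u x ^ 2) (2 * u x * deriv u x) x := fun x => by
    simpa using (hu x).hasDerivAt.fun_pow 2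
  have hint : Integrable (fun x => 2 * u x * deriv u x) := by
    refine (hi.add hi').mono'
      ((continuous_const.mul hu.continuous).mul hu').aestronglyMeasurable ?_
    refine ae_of_all _ fun x => ?_
    rw [Real.norm_eq_abs, abs_le, Pi.add_apply]
    constructor <;> nlinarith [sq_nonneg (u x - deriv u x), sq_nonneg (u x + deriv u x)]
  have key : ∀ l : Filter ℝ, Tendsto (fun x => u x ^ 2) l (nhds 0) → Tendsto u l (nhds 0) := by
    intro l hl
    have h := hl.sqrt
    simp only [Real.sqrt_sq_eq_abs, Real.sqrt_zero] at h
    exact tendsto_zero_iff_abs_tendsto_zero u |>.2 h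
  refine ⟨hint, key _ ?_, key _ ?_⟩
  · exact tendsto_zero_of_hasDerivAt_of_integrableOn_Ioi (a := 0) (fun x _ => hd x)
      hint.integrableOn hi.integrableOn
  · exact tendsto_zero_of_hasDerivAt_of_integrableOn_Iic (a := 0) (fun x _ => hd x)
      hint.integrableOn hi.integrableOn

/-- The energy of a positive `H¹` solution of `u'' + u^(p-1) = λ u` vanishes. -/
theorem deriv_sq_eq_of_stationary {p lam : ℝ} (hp : 2 < p) {u : ℝ → ℝ} (hu : ContDiff ℝ 2 u)
    (hpos : ∀ x, 0 < u x) (hi' : Integrable (fun x => deriv u x ^ 2))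
    (htop : Tendsto u atTop (nhds 0))
    (heq : ∀ x, deriv (deriv u) x + u x ^ (p - 1) = lam * u x) (x : ℝ) :
    deriv u x ^ 2 = lam * u x ^ 2 - 2 / p * u x ^ p := by
  have hdu : Differentiable ℝ u := hu.differentiable (by norm_num)
  have hddu : Differentiable ℝ (deriv u) :=
    ((contDiff_succ_iff_deriv (n := 1)).1 (by simpa [one_add_one_eq_two] using hu)).2.2.differentiable
      (by norm_num)
  set E : ℝ → ℝ := fun x => deriv u x ^ 2 - (lam * u x ^ 2 - 2 / p * u x ^ p) with hE
  have hp0 : p ≠ 0 := by linarith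
  have hEd : ∀ x, HasDerivAt E 0 x := by
    intro x
    have h1 := (hddu x).hasDerivAt.pow 2
    have h2 := ((hdu x).hasDerivAt.pow 2).const_mul lam
    have h3 := ((hdu x).hasDerivAt.rpow_const (p := p) (Or.inl (hpos x).ne')).const_mul (2 / p)
    refine (h1.sub (h2.sub h3)).congr_deriv ?_
    have h4 : deriv (deriv u) x = lam * u x - u x ^ (p - 1) := by linarith [heq x]
    rw [h4]
    field_simp
    ring
  have hconst : ∀ y, E y = E x := fun y =>
    is_const_of_deriv_eq_zero (fun z => (hEd z).differentiableAt) (fun z => (hEd z).deriv) y x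
  have hlim : Tendsto (fun y => deriv u y ^ 2) atTop (nhds (E x)) := by
    have h1 : Tendsto (fun y => E x + (lam * u y ^ 2 - 2 / p * u y ^ p)) atTop
        (nhds (E x + (lam * 0 ^ 2 - 2 / p * 0 ^ p))) :=
      (((htop.pow 2).const_mul lam).sub
        ((htop.rpow_const (Or.inr (by linarith))).const_mul (2 / p))).const_add _
    rw [Real.zero_rpow hp0] at h1
    refine (h1.congr fun y => ?_).trans_eq ?_
    · rw [← hconst y]; simp only [hE]; ring
    · simp
  have h0 : E x = 0 :=
    (hi'.integrableAtFilter atTop).eq_zero_of_tendsto (fun s hs => by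
      obtain ⟨a, ha⟩ := mem_atTop_sets.1 hs
      exact top_unique (by simpa using measure_mono (μ := volume) (s := Ici a) ha)) hlim
  simp only [hE] at h0
  linarith

theorem exists_deriv_eq_zero_of_tendsto_zero {u : ℝ → ℝ} (hu : Continuous u)
    (hpos : ∀ x, 0 < u x) (htop : Tendsto u atTop (nhds 0)) (hbot : Tendsto u atBot (nhds 0)) :
    ∃ x, deriv u x = 0 := by
  obtain ⟨x, hx⟩ := hu.exists_forall_ge' 0 (by
    rw [cocompact_eq_atBot_atTop]
    exact ((hbot.sup htop).eventually_lt_const (hpos 0)).mono fun _ h => h.le)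
  exact ⟨x, IsLocalMax.deriv_eq_zero (Eventually.of_forall hx)⟩

/-- In the supercritical regime `p > 6`, for every `m > 0` there is a mass threshold
`μ_m > 0` such that any positive `H¹` solution of `u'' + u^(p-1) = λ u` on `ℝ` with mass
`∫ u² = μ ≤ μ_m` has Lagrange multiplier `λ ≥ m`. -/
theorem stmt_19 (p m : ℝ) (hp : 6 < p) (hm : 0 < m) :
    ∃ μm : ℝ, 0 < μm ∧ ∀ μ lam : ℝ, 0 < μ → μ ≤ μm →
      ∀ u : ℝ → ℝ, ContDiff ℝ 2 u → (∀ x, 0 < u x) →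
        Integrable (fun x => u x ^ 2) → Integrable (fun x => deriv u x ^ 2) →
        (∫ x, u x ^ 2) = μ →
        (∀ x, deriv (deriv u) x + u x ^ (p - 1) = lam * u x) →
        m ≤ lam := by
  set a : ℝ := 2 / (p - 2) with ha
  have ha2 : a - 1 / 2 < 0 := by
    rw [ha, sub_neg, div_lt_div_iff₀ (by linarith) (by norm_num)]
    linarith
  refine ⟨m ^ (a - 1 / 2) / 2, by positivity, ?_⟩
  intro μ lam _ hμm u hu hpos hi hi' hmass heq
  by_contra! hlt
  have hdu : Differentiable ℝ u := hu.differentiable (by norm_num)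
  obtain ⟨hint, htop, hbot⟩ :=
    tendsto_zero_of_sq_integrable hdu (hu.continuous_deriv (by norm_num)) hi hi'
  have henergy := deriv_sq_eq_of_stationary (by linarith) hu hpos hi' htop heq
  obtain ⟨x₀, hx₀⟩ := exists_deriv_eq_zero_of_tendsto_zero hdu.continuous hpos htop hbot
  have hM := hpos x₀
  have hcrit : u x₀ ^ (p - 2) = p / 2 * lam := by
    have h := henergy x₀
    have hsplit : u x₀ ^ p = u x₀ ^ (p - 2) * u x₀ ^ 2 := by
      rw [← Real.rpow_natCast (u x₀) 2, ← Real.rpow_add hM]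
      norm_num
    rw [hx₀, hsplit] at h
    have h2 : (lam - 2 / p * u x₀ ^ (p - 2)) * u x₀ ^ 2 = 0 := by linarith
    have h3 := (mul_eq_zero.1 h2).resolve_right (by positivity)
    have hp0 : p ≠ 0 := by linarith
    field_simp at h3 ⊢
    linarith
  have hlam : 0 < lam := by
    have : 0 < p / 2 * lam := hcrit ▸ Real.rpow_pos_of_pos hM _
    exact pos_of_mul_pos_right this (by linarith)
  have hderiv : ∀ x, |deriv u x| ≤ √lam * u x := by
    intro x
    have hb : 0 ≤ √lam * u x := by have := hpos x; positivity
    refine abs_le_of_sq_le_sq ?_ hb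
    rw [mul_pow, Real.sq_sqrt hlam.le, henergy x]
    have : 0 ≤ 2 / p * u x ^ p :=
      mul_nonneg (div_nonneg (by norm_num) (by linarith)) (Real.rpow_nonneg (hpos x).le _)
    linarith
  have hmassM : u x₀ ^ 2 ≤ 2 * √lam * μ := by
    have hd : ∀ x ∈ Ici x₀, HasDerivAt (fun x => u x ^ 2) (2 * u x * deriv u x) x := fun x _ => by
      simpa using (hdu x).hasDerivAt.fun_pow 2
    have hftc := integral_Ioi_of_hasDerivAt_of_tendsto' hd hint.integrableOn (htop.pow 2)
    calc u x₀ ^ 2 = ∫ x in Ioi x₀, -(2 * u x * deriv u x) := by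
          rw [integral_neg, hftc]; simp
      _ ≤ ∫ x in Ioi x₀, 2 * √lam * u x ^ 2 := by
          refine integral_mono hint.neg.integrableOn (hi.const_mul _).integrableOn fun x => ?_
          nlinarith [(abs_le.1 (hderiv x)).1, hpos x]
      _ ≤ ∫ x, 2 * √lam * u x ^ 2 :=
          setIntegral_le_integral (hi.const_mul _) (ae_of_all _ fun x => by positivity)
      _ = 2 * √lam * μ := by rw [integral_const_mul, hmass]
  have hMa : lam ^ a ≤ u x₀ ^ 2 := by
    have h : u x₀ ^ 2 = (p / 2 * lam) ^ a := by
      rw [← hcrit, ← Real.rpow_mul hM.le, ha, mul_div_cancel₀ _ (by linarith), Real.rpow_two]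
    rw [h]
    exact Real.rpow_le_rpow hlam.le (by nlinarith) (div_nonneg (by norm_num) (by linarith))
  have hpow : m ^ (a - 1 / 2) < lam ^ (a - 1 / 2) := Real.rpow_lt_rpow_of_neg hlam hlt ha2
  have hsqrt : lam ^ (a - 1 / 2) * √lam = lam ^ a := by
    rw [Real.sqrt_eq_rpow, ← Real.rpow_add hlam]
    norm_num
  have hs : 0 < √lam := Real.sqrt_pos.2 hlam
  nlinarith [mul_lt_mul_of_pos_right hpow hs, mul_le_mul_of_nonneg_right hμm hs.le]
end
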